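/- For all integers a ≤ −3 and τ ≥ 0: C_{a,τ} · (0,1)ᵀ = (a+2, 1)ᵀ, whose slope 1/(a+2) satisfies 1/(a+2) < Λ^s; and C_{a,τ}⁻¹ · (0,1)ᵀ = (−a−2, −τ−(τ+1)(1+a))ᵀ, whose slope equals 1 + τ + 1/|a+2| and satisfies 1 + τ + 1/|a+2| > Λ^u. -/

import Mathlib

/-- For integers `a ≤ -3`, `τ ≥ 0`, the matrix
`C_{a,τ} = [[-τ-(τ+1)(1+a), a+2], [-(τ+1), 1]]`, viewed as a real matrix. -/
noncomputable def Cre (a τ : ℤ) : Matrix (Fin 2) (Fin 2) ℝ :=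
  !![-(τ : ℝ) - ((τ : ℝ) + 1) * (1 + (a : ℝ)), (a : ℝ) + 2; -((τ : ℝ) + 1), 1]

/-- The discriminant-type quantity `D_{a,τ} = (1+τ)² + 4(1+τ)/|a+2|`. -/
noncomputable def Dd (a τ : ℤ) : ℝ :=
  (1 + (τ : ℝ)) ^ 2 + 4 * (1 + (τ : ℝ)) / |(a : ℝ) + 2|

/-- The unstable slope `Λᵘ = (1 + τ + √D_{a,τ})/2` of `C_{a,τ}`. -/
noncomputable def Lu (a τ : ℤ) : ℝ := (1 + (τ : ℝ) + Real.sqrt (Dd a τ)) / 2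

/-- The stable slope `Λˢ = (1 + τ - √D_{a,τ})/2` of `C_{a,τ}`. -/
noncomputable def Ls (a τ : ℤ) : ℝ := (1 + (τ : ℝ) - Real.sqrt (Dd a τ)) / 2

theorem sqrt_Dd_lt {a τ : ℤ} (ha : (a : ℝ) + 2 < 0) (hτ : 0 ≤ τ) :
    Real.sqrt (Dd a τ) < 1 + (τ : ℝ) + 2 * (1 / |(a : ℝ) + 2|) := by
  have h_abs : 0 < |(a : ℝ) + 2| := abs_pos.mpr ha.ne
  have hτ' : (0 : ℝ) ≤ τ := by exact_mod_cast hτ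
  have h_inv : 0 < 1 / |(a : ℝ) + 2| := one_div_pos.mpr h_abs
  rw [Real.sqrt_lt' (by positivity), Dd, mul_div_assoc, div_eq_mul_one_div (1 + (τ : ℝ))]
  nlinarith [pow_pos h_inv 2]

/-- For all integers `a ≤ -3` and `τ ≥ 0`: `C_{a,τ}·(0,1)ᵀ = (a+2, 1)ᵀ`, whose slope
`1/(a+2)` satisfies `1/(a+2) < Λˢ`; and `C_{a,τ}⁻¹·(0,1)ᵀ = (-a-2, -τ-(τ+1)(1+a))ᵀ`,
whose slope equals `1 + τ + 1/|a+2|` and satisfies `1 + τ + 1/|a+2| > Λᵘ`. -/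
theorem stmt_11 (a τ : ℤ) (ha : a ≤ -3) (hτ : 0 ≤ τ) :
    (Cre a τ).mulVec ![0, 1] = ![(a : ℝ) + 2, 1] ∧
    1 / ((a : ℝ) + 2) < Ls a τ ∧
    (Cre a τ)⁻¹.mulVec ![0, 1] =
      ![-(a : ℝ) - 2, -(τ : ℝ) - ((τ : ℝ) + 1) * (1 + (a : ℝ))] ∧
    (-(τ : ℝ) - ((τ : ℝ) + 1) * (1 + (a : ℝ))) / (-(a : ℝ) - 2) =
      1 + (τ : ℝ) + 1 / |(a : ℝ) + 2| ∧
    Lu a τ < 1 + (τ : ℝ) + 1 / |(a : ℝ) + 2| := by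
  have ha' : (a : ℝ) + 2 < 0 := by
    have : (a : ℝ) ≤ -3 := by exact_mod_cast ha
    linarith
  have h_det : (Cre a τ).det = 1 := by
    rw [Cre, Matrix.det_fin_two_of]
    ring
  have h_sqrt := sqrt_Dd_lt ha' hτ
  rw [abs_of_neg ha'] at h_sqrt ⊢
  have hm : -(a : ℝ) - 2 ≠ 0 := by linarith
  have h_inv : 1 / ((a : ℝ) + 2) = -(1 / -((a : ℝ) + 2)) := by
    rw [one_div_neg_eq_neg_one_div, neg_neg]
  refine ⟨?_, ?_, ?_, ?_, ?_⟩
  · ext i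
    fin_cases i <;> simp [Cre, Matrix.mulVec, dotProduct]
  · rw [Ls, h_inv]
    linarith
  · rw [Matrix.inv_def, h_det, Ring.inverse_one, one_smul, Cre, Matrix.adjugate_fin_two_of]
    ext i
    fin_cases i <;> simp [Matrix.mulVec, dotProduct]
    ring
  · rw [show -((a : ℝ) + 2) = -(a : ℝ) - 2 by ring]
    field_simp
    ring
  · rw [Lu]
    linarith
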